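/- For every k ∈ ℤ³ \ {0} and every δ with 0 < δ < 77/624 there exists a constant C > 0 such that for all real k_F ≥ 1 the following holds: setting N := #{q ∈ ℤ³ : |q| ≤ k_F}, one has ∑ 1/(|p|² − |p − k|²) ≤ C·N^{1/3 − δ}, where the sum runs over all p ∈ ℤ³ with |p| > k_F ≥ |p − k| and |p|² − |p − k|² ≤ 4·N^{1/3 − δ}. -/

import Mathlib

open scoped BigOperators

/-- Euclidean norm of a lattice point in `ℤ³`. -/
noncomputable def latNorm (p : Fin 3 → ℤ) : ℝ := Real.sqrt (∑ i, ((p i : ℝ)) ^ 2)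


lemma aux_exists_B (t : ℝ) (ht : 0 < t) : ∃ B : ℝ, 1 ≤ B ∧ ∀ e : ℕ, (e : ℝ) + 1 ≤ B * (1 + t) ^ e := by
  refine ⟨1 + 1 / t, by have : 0 < 1 / t := by positivity
                        linarith, fun e => ?_⟩
  have h1 : 1 + (e : ℝ) * t ≤ (1 + t) ^ e := one_add_mul_le_pow (by linarith) e
  have h2 : (1 + 1 / t) * (1 + e * t) ≤ (1 + 1 / t) * (1 + t) ^ e := by gcongr
  have h3 : (1 + 1 / t) * (1 + e * t) = 1 + e + e * t + 1 / t := by field_simp; ring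
  have : 0 ≤ e * t := by positivity
  have : 0 < 1 / t := by positivity
  linarith

lemma aux_divisor_bound (η : ℝ) (hη : 0 < η) :
    ∃ C : ℝ, 1 ≤ C ∧ ∀ n : ℕ, n ≠ 0 → (n.divisors.card : ℝ) ≤ C * (n : ℝ) ^ η := by
  have h2 : (1 : ℝ) < 2 ^ η := Real.one_lt_rpow (by norm_num) hη
  obtain ⟨B, hB1, hB⟩ := aux_exists_B ((2 : ℝ) ^ η - 1) (by linarith)
  obtain ⟨P, hP⟩ := exists_nat_gt ((2 : ℝ) ^ (1 / η))
  refine ⟨B ^ P, one_le_pow₀ hB1, fun n hn => ?_⟩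
  have key : ∀ p ∈ n.primeFactors, ((n.factorization p + 1 : ℕ) : ℝ) ≤
      (if p < P then B else 1) * ((p ^ n.factorization p : ℕ) : ℝ) ^ η := by
    intro p hp
    have hpp := Nat.prime_of_mem_primeFactors hp
    have hp2 : (2 : ℝ) ≤ p := by exact_mod_cast hpp.two_le
    have hpow : ((p ^ n.factorization p : ℕ) : ℝ) ^ η = ((p : ℝ) ^ η) ^ n.factorization p := by
      push_cast
      rw [← Real.rpow_natCast, ← Real.rpow_natCast, ← Real.rpow_mul (by positivity),
        ← Real.rpow_mul (by positivity), mul_comm]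
    rw [hpow]
    push_cast
    split_ifs with h
    · refine (hB _).trans ?_
      have : (2 : ℝ) ^ η ≤ (p : ℝ) ^ η := Real.rpow_le_rpow (by norm_num) hp2 hη.le
      gcongr
      linarith
    · have h3 : (2 : ℝ) ≤ (p : ℝ) ^ η := by
        have : (2 : ℝ) ^ (1 / η) ≤ p := hP.le.trans (by exact_mod_cast not_lt.mp h)
        calc (2 : ℝ) = ((2 : ℝ) ^ (1 / η)) ^ η := by
              rw [← Real.rpow_mul (by norm_num)]; simp [hη.ne']
          _ ≤ _ := Real.rpow_le_rpow (by positivity) this hη.le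
      have h4 : (n.factorization p : ℝ) + 1 ≤ 2 ^ n.factorization p := by
        exact_mod_cast Nat.lt_two_pow_self
      rw [one_mul]
      exact h4.trans (by gcongr)
  have hn' : (n : ℝ) ^ η = ∏ p ∈ n.primeFactors, ((p ^ n.factorization p : ℕ) : ℝ) ^ η := by
    rw [Real.finsetProd_rpow _ _ (fun _ _ => by positivity)]
    congr 1
    have := Nat.prod_factorization_pow_eq_self hn
    conv_lhs => rw [← this]
    rw [Finsupp.prod]
    push_cast
    rfl
  rw [Nat.card_divisors hn, hn']
  push_cast
  push_cast at key
  refine (Finset.prod_le_prod (fun _ _ => by positivity) key).trans ?_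
  rw [Finset.prod_mul_distrib]
  refine mul_le_mul_of_nonneg_right ?_ (Finset.prod_nonneg fun _ _ => by positivity)
  rw [Finset.prod_ite]
  simp only [Finset.prod_const, one_pow, mul_one]
  refine pow_le_pow_right₀ hB1 ?_
  refine (Finset.card_le_card (t := Finset.range P) ?_).trans (by simp)
  intro p hp
  simp at hp ⊢
  exact hp.2

lemma aux_h_dvd (n a b : ℤ) (g h : ℤ) (hg : g = Int.gcd n a) (hn : n ≠ 0) (hgh : n = g * h)
    (hab : n ∣ a * b) : h ∣ b := by
  have hg0 : g ≠ 0 := by rintro rfl; simp at hgh; exact hn hgh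
  obtain ⟨a', ha'⟩ : g ∣ a := by rw [hg]; exact Int.gcd_dvd_right ..
  have hcop : IsCoprime h a' := by
    have hb := Int.gcd_eq_gcd_ab n a
    rw [← hg] at hb
    refine ⟨Int.gcdA n a, Int.gcdB n a, ?_⟩
    have : g * (Int.gcdA n a * h + Int.gcdB n a * a') = g * 1 := by
      linear_combination -hb - (Int.gcdA n a) * hgh - (Int.gcdB n a) * ha'
    exact mul_left_cancel₀ hg0 this
  have : g * h ∣ g * (a' * b) := by rw [← hgh, ← mul_assoc, ← ha']; exact hab
  exact hcop.dvd_of_dvd_mul_left ((mul_dvd_mul_iff_left hg0).1 this)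

lemma aux_prim_fibre (d n : ℤ) (hd : 1 ≤ d) (hn : 1 ≤ n) (x0 y0 x y x1 y1 : ℤ) (g h : ℤ)
    (e : ℤ) (he : e = Int.gcd g h)
    (e0 : x0 ^ 2 + d * y0 ^ 2 = n) (ee : x ^ 2 + d * y ^ 2 = n) (e1 : x1 ^ 2 + d * y1 ^ 2 = n)
    (c0 : IsCoprime x0 y0) (c : IsCoprime x y) (c1 : IsCoprime x1 y1)
    (hgh : n = g * h) (hg : g = Int.gcd n (x * y0 - x0 * y))
    (hg1 : g = Int.gcd n (x1 * y0 - x0 * y1)) :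
    ∃ j : ℤ, e * (x * y1 - x1 * y) = n * j ∧ j ^ 2 ≤ 4 := by
  have cop : ∀ u v : ℤ, u ^ 2 + d * v ^ 2 = n → IsCoprime u v → IsCoprime n v := by
    intro u v h1 h2
    rw [← h1, sq v, ← mul_assoc]
    exact (h2.pow_left).add_mul_right_left _
  have k0 := cop _ _ e0 c0
  have kk := cop _ _ ee c
  have hn0 : n ≠ 0 := by omega
  have ga : g ∣ x * y0 - x0 * y := by rw [hg]; exact Int.gcd_dvd_right ..
  have gb : g ∣ x1 * y0 - x0 * y1 := by rw [hg1]; exact Int.gcd_dvd_right ..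
  have ha : h ∣ x * y0 + x0 * y := aux_h_dvd n _ _ g h hg hn0 hgh
    ⟨y0 ^ 2 - y ^ 2, by linear_combination y0 ^ 2 * ee - y ^ 2 * e0⟩
  have hb : h ∣ x1 * y0 + x0 * y1 := aux_h_dvd n _ _ g h hg1 hn0 hgh
    ⟨y0 ^ 2 - y1 ^ 2, by linear_combination y0 ^ 2 * e1 - y1 ^ 2 * e0⟩
  have gn : g ∣ n := ⟨h, hgh⟩
  have hn' : h ∣ n := ⟨g, by rw [hgh]; ring⟩
  have gc : g ∣ x * y1 - x1 * y := by
    refine (k0.of_isCoprime_of_dvd_left gn).dvd_of_dvd_mul_left (?_ : g ∣ y0 * _)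
    have : y0 * (x * y1 - x1 * y) = y1 * (x * y0 - x0 * y) - y * (x1 * y0 - x0 * y1) := by ring
    rw [this]
    exact dvd_sub (ga.mul_left _) (gb.mul_left _)
  have hc : h ∣ x * y1 - x1 * y := by
    refine (k0.of_isCoprime_of_dvd_left hn').dvd_of_dvd_mul_left (?_ : h ∣ y0 * _)
    have : y0 * (x * y1 - x1 * y) = y1 * (x * y0 + x0 * y) - y * (x1 * y0 + x0 * y1) := by ring
    rw [this]
    exact dvd_sub (ha.mul_left _) (hb.mul_left _)
  have eg : e ∣ g := by rw [he]; exact Int.gcd_dvd_left ..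
  have eh : e ∣ h := by rw [he]; exact Int.gcd_dvd_right ..
  have en : e ∣ n := eg.trans gn
  have e2x : e ∣ 2 * x0 := by
    refine (kk.of_isCoprime_of_dvd_left en).dvd_of_dvd_mul_left (?_ : e ∣ y * _)
    have : y * (2 * x0) = (x * y0 + x0 * y) - (x * y0 - x0 * y) := by ring
    rw [this]
    exact dvd_sub (eh.trans ha) (eg.trans ga)
  have e2n : e ^ 2 ∣ n := by rw [hgh, sq]; exact mul_dvd_mul eg eh
  have e24 : e ^ 2 ∣ 4 * d := by
    have cc : IsCoprime (e ^ 2) (y0 ^ 2) := (k0.of_isCoprime_of_dvd_left en).pow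
    refine cc.dvd_of_dvd_mul_left (?_ : e ^ 2 ∣ y0 ^ 2 * _)
    have : y0 ^ 2 * (4 * d) = 4 * n - (2 * x0) ^ 2 := by linear_combination 4 * e0
    rw [this]
    exact dvd_sub (e2n.mul_left _) (pow_dvd_pow_of_dvd e2x 2)
  have e2le : e ^ 2 ≤ 4 * d := Int.le_of_dvd (by omega) e24
  have nd : n ∣ e * (x * y1 - x1 * y) := by
    obtain ⟨r, hr⟩ := gc
    obtain ⟨s, hs⟩ := hc
    have hbz := Int.gcd_eq_gcd_ab g h
    rw [← he] at hbz
    refine ⟨Int.gcdA g h * s + Int.gcdB g h * r, ?_⟩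
    rw [hbz, add_mul]
    nth_rewrite 1 [hs]
    rw [hr, hgh]; ring
  obtain ⟨j, hj⟩ := nd
  refine ⟨j, hj, ?_⟩
  have hL : (x * x1 + d * y * y1) ^ 2 + d * (x * y1 - x1 * y) ^ 2 = n ^ 2 := by
    linear_combination (x1 ^ 2 + d * y1 ^ 2) * ee + n * e1
  have hc2 : d * (x * y1 - x1 * y) ^ 2 ≤ n ^ 2 := by nlinarith [sq_nonneg (x * x1 + d * y * y1)]
  have h5 : d * n ^ 2 * j ^ 2 ≤ d * n ^ 2 * 4 := by
    calc d * n ^ 2 * j ^ 2 = d * (n * j) ^ 2 := by ring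
      _ = e ^ 2 * (d * (x * y1 - x1 * y) ^ 2) := by rw [← hj]; ring
      _ ≤ e ^ 2 * n ^ 2 := by gcongr
      _ ≤ (4 * d) * n ^ 2 := by gcongr
      _ = _ := by ring
  exact le_of_mul_le_mul_left h5 (by positivity)

lemma aux_prim_count (d : ℤ) (hd : 1 ≤ d) (n : ℕ) (hn : 1 ≤ n) (S : Finset (ℤ × ℤ))
    (hS : ∀ s ∈ S, s.1 ^ 2 + d * s.2 ^ 2 = n ∧ IsCoprime s.1 s.2) :
    S.card ≤ 10 * n.divisors.card := by
  rcases S.eq_empty_or_nonempty with rfl | ⟨⟨x0, y0⟩, h0⟩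
  · simp
  have hn0 : (n : ℤ) ≠ 0 := by omega
  refine Finset.card_le_mul_card_image_of_maps_to
    (f := fun s : ℤ × ℤ => Int.gcd n (s.1 * y0 - x0 * s.2)) ?_ 10 ?_
  · intro s hs
    simp only [Nat.mem_divisors]
    refine ⟨?_, by omega⟩
    have := Int.gcd_dvd_left (n : ℤ) (s.1 * y0 - x0 * s.2)
    exact_mod_cast this
  intro g hg
  rcases (S.filter fun s : ℤ × ℤ => Int.gcd n (s.1 * y0 - x0 * s.2) = g).eq_empty_or_nonempty
    with hem | ⟨⟨x1, y1⟩, h1⟩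
  · rw [hem]; simp
  obtain ⟨h, hh⟩ := (Nat.mem_divisors.1 hg).1
  have h1' := (Finset.mem_filter.1 h1)
  have g0 : (g : ℤ) ≠ 0 := by rintro hz; apply hn0; rw [hh]; push_cast; rw [hz]; simp
  have key : ∀ s ∈ S.filter (fun s : ℤ × ℤ => Int.gcd n (s.1 * y0 - x0 * s.2) = g),
      ∃ j : ℤ, ((Int.gcd g h : ℕ) : ℤ) * (s.1 * y1 - x1 * s.2) = n * j ∧ j ^ 2 ≤ 4 := by
    intro s hs
    have hs' := Finset.mem_filter.1 hs
    exact aux_prim_fibre d n hd (by omega) x0 y0 s.1 s.2 x1 y1 g h _ rfl (hS _ h0).1 (hS _ hs'.1).1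
      (hS _ h1'.1).1 (hS _ h0).2 (hS _ hs'.1).2 (hS _ h1'.1).2 (by rw [hh]; push_cast; rfl)
      (by rw [hs'.2]) (by rw [h1'.2])
  have e1 := (hS _ h1'.1).1
  simp only at e1
  choose! J hJ using key
  have hcard : ((Finset.Icc (-2 : ℤ) 2) ×ˢ (Finset.univ : Finset Bool)).card = 10 := by decide
  rw [← hcard]
  refine Finset.card_le_card_of_injOn
    (fun s => (J s, decide (0 ≤ s.1 * x1 + d * s.2 * y1))) ?_ ?_
  · intro s hs
    have := (hJ s hs).2
    simp only [Finset.coe_product, Set.mem_prod, Finset.mem_coe, Finset.mem_Icc, Finset.mem_univ, and_true]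
    constructor <;> nlinarith
  · intro s hs t ht hst
    simp only [Prod.mk.injEq, decide_eq_decide] at hst
    obtain ⟨hj, hsg⟩ := hst
    have a1 := (hJ s hs).1
    have a2 := (hJ t ht).1
    have es := (hS _ (Finset.mem_filter.1 hs).1).1
    have et := (hS _ (Finset.mem_filter.1 ht).1).1
    have ge0 : ((Int.gcd g h : ℕ) : ℤ) ≠ 0 := by
      intro hz
      have : Int.gcd g h = 0 := by exact_mod_cast hz
      rw [Int.gcd_eq_zero_iff] at this
      exact g0 this.1
    have hc : s.1 * y1 - x1 * s.2 = t.1 * y1 - x1 * t.2 := by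
      apply mul_left_cancel₀ ge0
      rw [a1, a2, hj]
    have hL : ∀ u : ℤ × ℤ, u.1 ^ 2 + d * u.2 ^ 2 = n →
        (u.1 * x1 + d * u.2 * y1) ^ 2 + d * (u.1 * y1 - x1 * u.2) ^ 2 = (n : ℤ) ^ 2 := by
      intro u hu
      linear_combination (x1 ^ 2 + d * y1 ^ 2) * hu + (n : ℤ) * e1
    have hD2 : (s.1 * x1 + d * s.2 * y1) ^ 2 = (t.1 * x1 + d * t.2 * y1) ^ 2 := by
      have q1 := hL s es
      have q2 := hL t et
      rw [hc] at q1
      linarith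
    have hD : s.1 * x1 + d * s.2 * y1 = t.1 * x1 + d * t.2 * y1 := by
      rcases sq_eq_sq_iff_eq_or_eq_neg.1 hD2 with h | h
      · exact h
      · by_cases hp : 0 ≤ s.1 * x1 + d * s.2 * y1
        · have := hsg.1 hp
          omega
        · have : ¬ (0 ≤ t.1 * x1 + d * t.2 * y1) := fun h => hp (hsg.2 h)
          omega
    ext
    · apply mul_left_cancel₀ hn0
      rw [← e1]
      linear_combination x1 * hD + d * y1 * hc
    · apply mul_left_cancel₀ hn0
      rw [← e1]
      linear_combination y1 * hD - x1 * hc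

lemma aux_count (d : ℤ) (hd : 1 ≤ d) (n : ℕ) (hn : 1 ≤ n) (S : Finset (ℤ × ℤ))
    (hS : ∀ s ∈ S, s.1 ^ 2 + d * s.2 ^ 2 = n) :
    S.card ≤ 10 * n.divisors.card * n.divisors.card := by
  have gd : ∀ s ∈ S, (Int.gcd s.1 s.2) ^ 2 ∣ n := by
    intro s hs
    have h1 : ((Int.gcd s.1 s.2 : ℕ) : ℤ) ^ 2 ∣ n := by
      rw [← hS s hs]
      exact dvd_add (pow_dvd_pow_of_dvd (Int.gcd_dvd_left ..) 2)
        ((pow_dvd_pow_of_dvd (Int.gcd_dvd_right ..) 2).mul_left _)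
    exact_mod_cast h1
  refine Finset.card_le_mul_card_image_of_maps_to
    (f := fun s : ℤ × ℤ => Int.gcd s.1 s.2) ?_ _ ?_
  · intro s hs
    exact Nat.mem_divisors.2 ⟨(dvd_pow_self _ two_ne_zero).trans (gd s hs), by omega⟩
  intro g hg
  rcases (S.filter fun s : ℤ × ℤ => Int.gcd s.1 s.2 = g).eq_empty_or_nonempty
    with hem | ⟨s1, h1⟩
  · rw [hem]; simp
  have h1' := Finset.mem_filter.1 h1
  obtain ⟨q, hq⟩ := gd s1 h1'.1
  rw [h1'.2] at hq
  have hq0 : 1 ≤ q := by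
    rcases Nat.eq_zero_or_pos q with h | h
    · subst h; omega
    · exact h
  have g0 : g ≠ 0 := by rintro rfl; simp at hq; omega
  have g0' : (g : ℤ) ≠ 0 := by exact_mod_cast g0
  have hdec : ∀ s ∈ S.filter (fun s : ℤ × ℤ => Int.gcd s.1 s.2 = g),
      s.1 = g * (s.1 / g) ∧ s.2 = g * (s.2 / g) := by
    intro s hs
    have := (Finset.mem_filter.1 hs).2
    constructor
    · exact (Int.mul_ediv_cancel' (by rw [← this]; exact Int.gcd_dvd_left ..)).symm
    · exact (Int.mul_ediv_cancel' (by rw [← this]; exact Int.gcd_dvd_right ..)).symm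
  have hle : q.divisors.card ≤ n.divisors.card :=
    Finset.card_le_card (Nat.divisors_subset_of_dvd (by omega) ⟨g ^ 2, by rw [hq]; ring⟩)
  refine le_trans ?_ (Nat.mul_le_mul_left 10 hle)
  rw [← Finset.card_image_of_injOn (f := fun s : ℤ × ℤ => (s.1 / (g : ℤ), s.2 / (g : ℤ)))]
  · refine aux_prim_count d hd q hq0 _ ?_
    intro t ht
    obtain ⟨s, hs, rfl⟩ := Finset.mem_image.1 ht
    obtain ⟨ha, hb⟩ := hdec s hs
    have hs' := Finset.mem_filter.1 hs
    constructor
    · have := hS s hs'.1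
      rw [ha, hb, hq] at this
      have h2 : (g : ℤ) ^ 2 ≠ 0 := pow_ne_zero _ g0'
      apply mul_left_cancel₀ h2
      push_cast at this
      linear_combination this
    · have := Int.isCoprime_iff_gcd_eq_one.2 (Int.gcd_div_gcd_div_gcd (i := s.1) (j := s.2)
        (by rw [hs'.2]; omega))
      rw [hs'.2] at this
      exact this
  · intro s hs t ht hst
    simp only [Prod.mk.injEq] at hst
    obtain ⟨ha, hb⟩ := hdec s hs
    obtain ⟨ha', hb'⟩ := hdec t ht
    ext
    · rw [ha, ha', hst.1]
    · rw [hb, hb', hst.2]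

lemma aux_rep_bound (d : ℤ) (hd : 1 ≤ d) : ∃ C : ℝ, 1 ≤ C ∧ ∀ (n : ℤ) (X : ℝ), 1 ≤ X → (n : ℝ) ≤ X →
    ∀ S : Finset (ℤ × ℤ), (∀ s ∈ S, s.1 ^ 2 + d * s.2 ^ 2 = n) → (S.card : ℝ) ≤ C * X ^ (1 / 20 : ℝ) := by
  obtain ⟨C, hC1, hC⟩ := aux_divisor_bound (1 / 40) (by norm_num)
  refine ⟨10 * C ^ 2, by nlinarith, fun n X hX hnX S hS => ?_⟩
  have hX1 : 1 ≤ X ^ (1 / 20 : ℝ) := Real.one_le_rpow hX (by norm_num)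
  rcases le_or_gt n 0 with hn | hn
  · have : S ⊆ {(0, 0)} := by
      intro s hs
      have h := hS s hs
      have h1 : s.1 ^ 2 = 0 := by nlinarith [sq_nonneg s.1, sq_nonneg s.2, mul_nonneg (by omega : 0 ≤ d) (sq_nonneg s.2)]
      have h2 : s.2 ^ 2 = 0 := by nlinarith [sq_nonneg s.1, sq_nonneg s.2]
      simp at h1 h2
      simp [Prod.ext_iff, h1, h2]
    have := Finset.card_le_card this
    simp at this
    have : (S.card : ℝ) ≤ 1 := by exact_mod_cast this
    nlinarith
  · lift n to ℕ using hn.le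
    have h1 := aux_count d hd n (by omega) S hS
    have h2 := hC n (by omega)
    have h3 : (n : ℝ) ^ (1 / 40 : ℝ) ≤ X ^ (1 / 40 : ℝ) :=
      Real.rpow_le_rpow (by positivity) (by exact_mod_cast hnX) (by norm_num)
    have h4 : X ^ (1 / 20 : ℝ) = X ^ (1 / 40 : ℝ) * X ^ (1 / 40 : ℝ) := by
      rw [← Real.rpow_add (by linarith)]; norm_num
    have h5 : (S.card : ℝ) ≤ 10 * n.divisors.card * n.divisors.card := by exact_mod_cast h1
    have h6 : (n.divisors.card : ℝ) ≤ C * X ^ (1 / 40 : ℝ) := h2.trans (by gcongr)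
    calc (S.card : ℝ) ≤ 10 * n.divisors.card * n.divisors.card := h5
      _ ≤ 10 * (C * X ^ (1 / 40 : ℝ)) * (C * X ^ (1 / 40 : ℝ)) := by gcongr
      _ = _ := by rw [h4]; ring

lemma aux_diam (T : Finset ℤ) (L : ℝ) (hL : 0 ≤ L) (h : ∀ x ∈ T, ∀ y ∈ T, (y : ℝ) - x ≤ L) :
    (T.card : ℝ) ≤ L + 1 := by
  rcases T.eq_empty_or_nonempty with rfl | hT
  · simp; linarith
  have hsub : T ⊆ Finset.Icc (T.min' hT) (T.min' hT + ⌊L⌋) := by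
    intro y hy
    rw [Finset.mem_Icc]
    refine ⟨T.min'_le y hy, ?_⟩
    have := h _ (T.min'_mem hT) y hy
    have : y - T.min' hT ≤ ⌊L⌋ := Int.le_floor.2 (by push_cast; exact this)
    omega
  have h1 := Finset.card_le_card hsub
  rw [Int.card_Icc] at h1
  have h0 : 0 ≤ ⌊L⌋ := Int.floor_nonneg.2 hL
  have h2 : (T.card : ℤ) ≤ ⌊L⌋ + 1 := by omega
  have h3 : (T.card : ℝ) ≤ ⌊L⌋ + 1 := by exact_mod_cast h2
  linarith [Int.floor_le L]

lemma aux_card_abs (T : Finset ℤ) (L : ℝ) (hL : 1 ≤ L) (h : ∀ x ∈ T, (x : ℝ) ^ 2 ≤ L ^ 2) :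
    (T.card : ℝ) ≤ 3 * L := by
  have := aux_diam T (2 * L) (by linarith) (fun x hx y hy => by
    have h1 := abs_le.1 (abs_le_of_sq_le_sq (h x hx) (by linarith))
    have h2 := abs_le.1 (abs_le_of_sq_le_sq (h y hy) (by linarith))
    linarith [h1.1, h2.2])
  linarith

lemma aux_half_annulus (α β E W : ℝ) (hα : 1 ≤ α) (hβ : 1 ≤ β) (hE : 1 ≤ E) (hW : 0 ≤ W)
    (S : Finset (ℤ × ℤ))
    (hS : ∀ s ∈ S, E - W ≤ α * (s.1 : ℝ) ^ 2 + β * (s.2 : ℝ) ^ 2 ∧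
      α * (s.1 : ℝ) ^ 2 + β * (s.2 : ℝ) ^ 2 ≤ E ∧ E / 4 ≤ α * (s.1 : ℝ) ^ 2) :
    (S.card : ℝ) ≤ 6 * (√E + W) := by
  have hsq : √E ^ 2 = E := Real.sq_sqrt (by linarith)
  have hs1 : 1 ≤ √E := Real.one_le_sqrt.2 hE
  classical
  set T := S.image Prod.snd with hT
  have hTc : (T.card : ℝ) ≤ 3 * √E := by
    refine aux_card_abs T _ hs1 ?_
    intro y hy
    obtain ⟨s, hs, rfl⟩ := Finset.mem_image.1 hy
    rw [hsq]
    nlinarith [(hS s hs).2.1, sq_nonneg (s.1 : ℝ), sq_nonneg (s.2 : ℝ)]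
  have half : ∀ U : Finset ℤ, (∀ x ∈ U, ∀ y ∈ U, α * (y : ℝ) ^ 2 - α * (x : ℝ) ^ 2 ≤ W) →
      (∀ x ∈ U, 0 ≤ x ∧ E / 4 ≤ α * (x : ℝ) ^ 2) → (U.card : ℝ) ≤ W / √E + 1 := by
    intro U h1 h2
    refine aux_diam U _ (by positivity) ?_
    intro x hx y hy
    rw [le_div_iff₀ (by linarith)]
    rcases le_or_gt y x with h | h
    · have : (y : ℝ) - x ≤ 0 := by
        have : (y : ℝ) ≤ x := by exact_mod_cast h
        linarith
      nlinarith
    · have hx0 : (0 : ℝ) ≤ x := by exact_mod_cast (h2 x hx).1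
      have hxy : (x : ℝ) < y := by exact_mod_cast h
      have hax : √E ≤ 2 * (α * x) := by
        apply Real.sqrt_le_iff.2
        constructor
        · positivity
        · have := (h2 x hx).2
          have : α * (x : ℝ) ^ 2 ≤ α * (α * (x : ℝ) ^ 2) := le_mul_of_one_le_left (by positivity) hα
          nlinarith
      calc ((y : ℝ) - x) * √E ≤ (y - x) * (2 * (α * x)) :=
            mul_le_mul_of_nonneg_left hax (by linarith)
        _ ≤ (y - x) * (α * x + α * y) := by
            refine mul_le_mul_of_nonneg_left ?_ (by linarith)
            nlinarith
        _ = α * (y : ℝ) ^ 2 - α * (x : ℝ) ^ 2 := by ring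
        _ ≤ W := h1 x hx y hy
  have fib : ∀ y ∈ T, ((S.filter fun s => s.2 = y).card : ℝ) ≤ 2 * (W / √E + 1) := by
    intro y hy
    set F := S.filter fun s => s.2 = y with hF
    set U := F.image Prod.fst with hU
    have hFU : F.card = U.card := by
      rw [hU, Finset.card_image_of_injOn]
      intro s hs t ht h
      have h1 := (Finset.mem_filter.1 hs).2
      have h2 := (Finset.mem_filter.1 ht).2
      ext
      · exact h
      · rw [h1, h2]
    have hUm : ∀ x ∈ U, E - W ≤ α * (x : ℝ) ^ 2 + β * (y : ℝ) ^ 2 ∧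
      α * (x : ℝ) ^ 2 + β * (y : ℝ) ^ 2 ≤ E ∧ E / 4 ≤ α * (x : ℝ) ^ 2 := by
      intro x hx
      obtain ⟨s, hs, rfl⟩ := Finset.mem_image.1 hx
      have := (Finset.mem_filter.1 hs)
      rw [← this.2]
      exact hS s this.1
    rw [hFU, ← Finset.card_filter_add_card_filter_not (s := U) (fun x => 0 ≤ x)]
    have b1 := half (U.filter fun x => 0 ≤ x) (by
      intro x hx y hy
      have := hUm x (Finset.mem_filter.1 hx).1
      have := hUm y (Finset.mem_filter.1 hy).1
      linarith) (by
      intro x hx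
      exact ⟨(Finset.mem_filter.1 hx).2, (hUm x (Finset.mem_filter.1 hx).1).2.2⟩)
    have b2 := half ((U.filter fun x => ¬ 0 ≤ x).image fun x => -x) (by
      intro x hx y hy
      obtain ⟨x', hx', rfl⟩ := Finset.mem_image.1 hx
      obtain ⟨y', hy', rfl⟩ := Finset.mem_image.1 hy
      have := hUm x' (Finset.mem_filter.1 hx').1
      have := hUm y' (Finset.mem_filter.1 hy').1
      push_cast
      rw [neg_sq, neg_sq]
      linarith) (by
      intro x hx
      obtain ⟨x', hx', rfl⟩ := Finset.mem_image.1 hx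
      have h1 := Finset.mem_filter.1 hx'
      refine ⟨by omega, ?_⟩
      push_cast
      rw [neg_sq]
      exact (hUm x' h1.1).2.2)
    rw [Finset.card_image_of_injective _ neg_injective] at b2
    push_cast
    linarith
  have hsum : S.card = ∑ y ∈ T, (S.filter fun s => s.2 = y).card :=
    Finset.card_eq_sum_card_image Prod.snd S
  rw [hsum]
  push_cast
  calc _ ≤ ∑ y ∈ T, 2 * (W / √E + 1) := Finset.sum_le_sum fib
    _ = T.card * (2 * (W / √E + 1)) := by simp
    _ ≤ (3 * √E) * (2 * (W / √E + 1)) := by gcongr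
    _ = 6 * (√E + W) := by field_simp; ring

lemma aux_annulus (d E W : ℝ) (hd : 1 ≤ d) (hE : 1 ≤ E) (hW : 0 ≤ W) (S : Finset (ℤ × ℤ))
    (hS : ∀ s ∈ S, E - W ≤ (s.1 : ℝ) ^ 2 + d * (s.2 : ℝ) ^ 2 ∧
      (s.1 : ℝ) ^ 2 + d * (s.2 : ℝ) ^ 2 ≤ E) :
    (S.card : ℝ) ≤ 18 * (√E + W) := by
  have hsq : √E ^ 2 = E := Real.sq_sqrt (by linarith)
  have hs1 : 1 ≤ √E := Real.one_le_sqrt.2 hE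
  classical
  rcases le_or_gt (E / 2) W with h | h
  · have hsub : S ⊆ S.image Prod.fst ×ˢ S.image Prod.snd := by
      intro s hs
      exact Finset.mem_product.2 ⟨Finset.mem_image_of_mem _ hs, Finset.mem_image_of_mem _ hs⟩
    have h1 := Finset.card_le_card hsub
    rw [Finset.card_product] at h1
    have b1 : ((S.image Prod.fst).card : ℝ) ≤ 3 * √E := by
      refine aux_card_abs _ _ hs1 ?_
      intro y hy
      obtain ⟨s, hs, rfl⟩ := Finset.mem_image.1 hy
      rw [hsq]
      nlinarith [(hS s hs).2, sq_nonneg (s.1 : ℝ), sq_nonneg (s.2 : ℝ)]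
    have b2 : ((S.image Prod.snd).card : ℝ) ≤ 3 * √E := by
      refine aux_card_abs _ _ hs1 ?_
      intro y hy
      obtain ⟨s, hs, rfl⟩ := Finset.mem_image.1 hy
      rw [hsq]
      nlinarith [(hS s hs).2, sq_nonneg (s.1 : ℝ), sq_nonneg (s.2 : ℝ)]
    have h2 : (S.card : ℝ) ≤ (S.image Prod.fst).card * (S.image Prod.snd).card := by exact_mod_cast h1
    have h3 : ((S.image Prod.fst).card : ℝ) * (S.image Prod.snd).card ≤ (3 * √E) * (3 * √E) := by gcongr
    nlinarith
  · rw [← Finset.card_filter_add_card_filter_not (s := S) (fun s => E / 4 ≤ (s.1 : ℝ) ^ 2)]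
    have b1 := aux_half_annulus 1 d E W le_rfl hd hE hW (S.filter fun s => E / 4 ≤ (s.1 : ℝ) ^ 2) (by
      intro s hs
      have h1 := Finset.mem_filter.1 hs
      have := hS s h1.1
      rw [one_mul]
      exact ⟨this.1, this.2, h1.2⟩)
    have b2 := aux_half_annulus d 1 E W hd le_rfl hE hW
      ((S.filter fun s => ¬ E / 4 ≤ (s.1 : ℝ) ^ 2).image Prod.swap) (by
      intro t ht
      obtain ⟨s, hs, rfl⟩ := Finset.mem_image.1 ht
      have h1 := Finset.mem_filter.1 hs
      have := hS s h1.1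
      have h2 := h1.2
      simp only [Prod.fst_swap, Prod.snd_swap, one_mul]
      refine ⟨by linarith, by linarith, by linarith⟩)
    rw [Finset.card_image_of_injective _ Prod.swap_injective] at b2
    push_cast
    have : 0 ≤ √E + W := by positivity
    linarith

/-- integer dot product -/
def zdot (p q : Fin 3 → ℤ) : ℤ := p 0 * q 0 + p 1 * q 1 + p 2 * q 2

/-- integer cross product -/
def zcross (k u : Fin 3 → ℤ) : Fin 3 → ℤ :=
  ![k 1 * u 2 - k 2 * u 1, k 2 * u 0 - k 0 * u 2, k 0 * u 1 - k 1 * u 0]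

lemma latNorm_sq (p : Fin 3 → ℤ) : latNorm p ^ 2 = (zdot p p : ℝ) := by
  unfold latNorm zdot
  rw [Real.sq_sqrt (Finset.sum_nonneg fun _ _ => sq_nonneg _), Fin.sum_univ_three]
  push_cast; ring

lemma latNorm_nonneg (p : Fin 3 → ℤ) : 0 ≤ latNorm p := Real.sqrt_nonneg _

lemma zdot_pos (p : Fin 3 → ℤ) (hp : p ≠ 0) : 1 ≤ zdot p p := by
  by_contra h
  apply hp
  unfold zdot at h
  have h0 : p 0 = 0 := by nlinarith [mul_self_nonneg (p 0), mul_self_nonneg (p 1), mul_self_nonneg (p 2)]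
  have h1 : p 1 = 0 := by nlinarith [mul_self_nonneg (p 0), mul_self_nonneg (p 1), mul_self_nonneg (p 2)]
  have h2 : p 2 = 0 := by nlinarith [mul_self_nonneg (p 0), mul_self_nonneg (p 1), mul_self_nonneg (p 2)]
  ext i
  fin_cases i <;> simp [h0, h1, h2]

lemma zdot_sub (p k : Fin 3 → ℤ) :
    zdot (p - k) (p - k) = zdot p p - (2 * zdot p k - zdot k k) := by
  simp [zdot]; ring

lemma zdot_sub_left (p q k : Fin 3 → ℤ) : zdot (p - q) k = zdot p k - zdot q k := by
  simp [zdot]; ring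

lemma exists_perp (k : Fin 3 → ℤ) : ∃ u : Fin 3 → ℤ, u ≠ 0 ∧ zdot k u = 0 := by
  by_cases h : k 0 = 0
  · refine ⟨![1, 0, 0], ?_, by simp [zdot, h]⟩
    intro h; simpa using congrFun h 0
  · refine ⟨![-k 1, k 0, 0], ?_, by simp [zdot]; ring⟩
    intro h'; exact h (by simpa using congrFun h' 1)

lemma gram (p k u : Fin 3 → ℤ) (hu : zdot k u = 0) :
    (zdot p (zcross k u)) ^ 2 + zdot k k * (zdot p u) ^ 2 =
      zdot u u * (zdot k k * zdot p p - (zdot p k) ^ 2) := by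
  simp only [zdot, zcross, Matrix.cons_val_zero, Matrix.cons_val_one, Matrix.cons_val] at hu ⊢
  linear_combination (-(p 0 * p 0 + p 1 * p 1 + p 2 * p 2) * (k 0 * u 0 + k 1 * u 1 + k 2 * u 2) + 2 *
   (p 0 * k 0 + p 1 * k 1 + p 2 * k 2) * (p 0 * u 0 + p 1 * u 1 + p 2 * u 2)) * hu

lemma zinj (k u : Fin 3 → ℤ) (hk : k ≠ 0) (hu0 : u ≠ 0) (hu : zdot k u = 0) (p q : Fin 3 → ℤ)
    (h1 : zdot p k = zdot q k) (h2 : zdot p u = zdot q u)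
    (h3 : zdot p (zcross k u) = zdot q (zcross k u)) : p = q := by
  by_contra hne
  have hpq := zdot_pos (p - q) (sub_ne_zero.2 hne)
  have g := gram (p - q) k u hu
  rw [zdot_sub_left p q, zdot_sub_left p q, zdot_sub_left p q k, h1, h2, h3] at g
  simp only [sub_self] at g
  have := zdot_pos k hk
  have := zdot_pos u hu0
  have : 0 < zdot u u * (zdot k k * zdot (p - q) (p - q)) := by positivity
  simp at g
  rcases g with g | g | g <;> simp_all

/-- the region, in integer terms -/
def Reg (k : Fin 3 → ℤ) (kF : ℝ) (j : ℕ) (p : Fin 3 → ℤ) : Prop :=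
  kF ^ 2 < (zdot p p : ℝ) ∧ (zdot p p : ℝ) - (2 * zdot p k - zdot k k : ℤ) ≤ kF ^ 2 ∧
    2 * zdot p k - zdot k k ≤ j

lemma Reg.pos {k : Fin 3 → ℤ} {kF : ℝ} {j : ℕ} {p : Fin 3 → ℤ} (h : Reg k kF j p) :
    1 ≤ 2 * zdot p k - zdot k k := by
  have : (0 : ℝ) < ((2 * zdot p k - zdot k k : ℤ) : ℝ) := by linarith [h.1, h.2.1]
  have : 0 < 2 * zdot p k - zdot k k := by exact_mod_cast this
  omega

lemma count_one (k : Fin 3 → ℤ) (hk : k ≠ 0) : ∃ C : ℝ, 0 < C ∧ ∀ kF : ℝ, 1 ≤ kF → ∀ j : ℕ, 1 ≤ j →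
    ∀ S : Finset (Fin 3 → ℤ), (∀ p ∈ S, Reg k kF j p) → (S.card : ℝ) ≤ C * (kF + (j : ℝ) ^ 2) := by
  classical
  obtain ⟨u, hu0, hu⟩ := exists_perp k
  have hd := zdot_pos k hk
  have hc := zdot_pos u hu0
  obtain ⟨d, hdd⟩ : ∃ d, d = zdot k k := ⟨_, rfl⟩
  obtain ⟨c, hcc⟩ : ∃ c, c = zdot u u := ⟨_, rfl⟩
  rw [← hdd] at hd
  rw [← hcc] at hc
  have hdR : (1 : ℝ) ≤ d := by exact_mod_cast hd
  have hcR : (1 : ℝ) ≤ c := by exact_mod_cast hc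
  have hcd : (1 : ℝ) ≤ c * d := by nlinarith
  refine ⟨d * (18 * (c * d + c * (1 + d) ^ 2)), by positivity, fun kF hkF j hj S hS => ?_⟩
  have hjR : (1 : ℝ) ≤ j := by exact_mod_cast hj
  have hreg : ∀ p ∈ S, 1 ≤ zdot p k ∧ zdot p k ≤ j + d ∧
      (c : ℝ) * (d * kF ^ 2 - (zdot p k : ℝ) ^ 2) <
        (zdot p (zcross k u) : ℝ) ^ 2 + d * (zdot p u : ℝ) ^ 2 ∧
      (zdot p (zcross k u) : ℝ) ^ 2 + d * (zdot p u : ℝ) ^ 2 ≤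
        c * (d * kF ^ 2 - ((zdot p k : ℝ) - d) ^ 2) := by
    intro p hp
    have h := hS p hp
    have hpos := h.pos
    obtain ⟨r1, r2, r3⟩ := h
    rw [← hdd] at r2 r3 hpos
    have g : (zdot p (zcross k u) : ℝ) ^ 2 + d * (zdot p u : ℝ) ^ 2 =
        c * (d * zdot p p - (zdot p k : ℝ) ^ 2) := by
      have := gram p k u hu
      rw [← hdd, ← hcc] at this
      exact_mod_cast this
    refine ⟨by omega, by omega, ?_, ?_⟩
    · rw [g]
      have : (d : ℝ) * kF ^ 2 < d * zdot p p := by gcongr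
      have h0 : (0 : ℝ) < c := by linarith
      exact mul_lt_mul_of_pos_left (by linarith) h0
    · rw [g]
      push_cast at r2
      have : (d : ℝ) * zdot p p ≤ d * (kF ^ 2 + (2 * zdot p k - d)) := by
        gcongr; linarith
      refine mul_le_mul_of_nonneg_left ?_ (by linarith)
      nlinarith
  set f : (Fin 3 → ℤ) → (ℤ × ℤ) := fun p => (zdot p (zcross k u), zdot p u) with hf
  set T := S.image f with hT
  have hTc : (T.card : ℝ) ≤ 18 * (√(c * d * kF ^ 2) + c * (j + d) ^ 2) := by
    refine aux_annulus d _ _ hdR (by nlinarith) (by positivity) T ?_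
    intro t ht
    obtain ⟨p, hp, rfl⟩ := Finset.mem_image.1 ht
    obtain ⟨a1, a2, a3, a4⟩ := hreg p hp
    have a1' : (1 : ℝ) ≤ zdot p k := by exact_mod_cast a1
    have a2' : (zdot p k : ℝ) ≤ j + d := by exact_mod_cast a2
    simp only [hf]
    constructor
    · have : (zdot p k : ℝ) ^ 2 ≤ (j + d) ^ 2 := by gcongr
      nlinarith
    · have : 0 ≤ (c : ℝ) * ((zdot p k : ℝ) - d) ^ 2 := by positivity
      nlinarith
  have hST : S.card ≤ (T ×ˢ Finset.Ico (0 : ℤ) d).card := by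
    refine Finset.card_le_card_of_injOn (fun p => (f p, zdot p k % d)) ?_ ?_
    · intro p hp
      simp only [Finset.coe_product, Set.mem_prod, Finset.mem_coe, Finset.mem_Ico]
      exact ⟨Finset.mem_image_of_mem _ hp, Int.emod_nonneg _ (by omega), Int.emod_lt_of_pos _ (by omega)⟩
    · intro p hp q hq hpq
      simp only [Prod.mk.injEq, hf] at hpq
      obtain ⟨⟨e1, e2⟩, e3⟩ := hpq
      obtain ⟨a1, a2, a3, a4⟩ := hreg p hp
      obtain ⟨b1, b2, b3, b4⟩ := hreg q hq
      rw [e1, e2] at a3 a4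
      have hlt : ∀ x y : ℤ, 1 ≤ x → (c : ℝ) * (d * kF ^ 2 - (x : ℝ) ^ 2) <
          c * (d * kF ^ 2 - ((y : ℝ) - d) ^ 2) → y - d < x := by
        intro x y hx h
        have h1 := lt_of_mul_lt_mul_left h (by linarith)
        have h2 : ((y : ℝ) - d) ^ 2 < (x : ℝ) ^ 2 := by linarith
        have h3 : (y - d) ^ 2 < x ^ 2 := by exact_mod_cast h2
        exact lt_of_pow_lt_pow_left₀ 2 (by omega) h3
      have l1 := hlt _ _ a1 (a3.trans_le b4)
      have l2 := hlt _ _ b1 (b3.trans_le a4)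
      have : zdot p k = zdot q k := by
        have hdv : d ∣ zdot p k - zdot q k := Int.ModEq.dvd (Eq.symm e3)
        have := Int.eq_zero_of_abs_lt_dvd hdv (by rw [abs_lt]; constructor <;> omega)
        omega
      exact zinj k u hk hu0 hu p q this e2 e1
  rw [Finset.card_product, Int.card_Ico] at hST
  have h1 : (S.card : ℝ) ≤ T.card * d := by
    have : (S.card : ℤ) ≤ T.card * d := by
      have e : ((d - 0).toNat : ℤ) = d := by simp; omega
      rw [← e]; exact_mod_cast hST
    exact_mod_cast this
  have h2 : √(c * d * kF ^ 2) ≤ c * d * kF := by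
    rw [Real.sqrt_le_iff]
    constructor
    · positivity
    · have : (c : ℝ) * d ≤ (c * d) ^ 2 := by nlinarith
      calc (c : ℝ) * d * kF ^ 2 ≤ (c * d) ^ 2 * kF ^ 2 := by gcongr
        _ = _ := by ring
  have h3 : (j + d : ℝ) ^ 2 ≤ (1 + d) ^ 2 * (j : ℝ) ^ 2 := by
    rw [← mul_pow]; gcongr; nlinarith
  calc (S.card : ℝ) ≤ T.card * d := h1
    _ ≤ (18 * (√(c * d * kF ^ 2) + c * (j + d) ^ 2)) * d := by gcongr
    _ ≤ (18 * (c * d * kF + c * ((1 + d) ^ 2 * (j : ℝ) ^ 2))) * d := by gcongr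
    _ ≤ _ := by
      have p1 : 0 ≤ (d : ℝ) * (18 * (c * d)) * (j : ℝ) ^ 2 := by positivity
      have p2 : 0 ≤ (d : ℝ) * (18 * (c * (1 + d) ^ 2)) * kF := by positivity
      nlinarith

lemma count_two (k : Fin 3 → ℤ) (hk : k ≠ 0) : ∃ C : ℝ, 0 < C ∧ ∀ kF : ℝ, 1 ≤ kF → ∀ j : ℕ, 1 ≤ j →
    (j : ℝ) ≤ kF → ∀ S : Finset (Fin 3 → ℤ), (∀ p ∈ S, Reg k kF j p) →
    (S.card : ℝ) ≤ C * kF ^ (1 / 10 : ℝ) * (j : ℝ) ^ 2 := by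
  classical
  obtain ⟨u, hu0, hu⟩ := exists_perp k
  have hd := zdot_pos k hk
  have hc := zdot_pos u hu0
  obtain ⟨d, hdd⟩ : ∃ d, d = zdot k k := ⟨_, rfl⟩
  obtain ⟨c, hcc⟩ : ∃ c, c = zdot u u := ⟨_, rfl⟩
  rw [← hdd] at hd
  rw [← hcc] at hc
  have hdR : (1 : ℝ) ≤ d := by exact_mod_cast hd
  have hcR : (1 : ℝ) ≤ c := by exact_mod_cast hc
  have hcd : (1 : ℝ) ≤ c * d := by nlinarith
  obtain ⟨C, hC1, hC⟩ := aux_rep_bound d hd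
  refine ⟨(1 + d) * 2 * (C * (2 * (c * d)) ^ (1 / 20 : ℝ)), by positivity, fun kF hkF j hj hjk S hS => ?_⟩
  have hjR : (1 : ℝ) ≤ j := by exact_mod_cast hj
  set f : (Fin 3 → ℤ) → (ℤ × ℤ) := fun p => (zdot p k, zdot p p) with hf
  set T := S.image f with hT
  have fib : ∀ t ∈ T, ((S.filter fun p => f p = t).card : ℝ) ≤
      C * (2 * (c * d) * kF ^ 2) ^ (1 / 20 : ℝ) := by
    intro t ht
    rw [← Finset.card_image_of_injOn (f := fun p : Fin 3 → ℤ => (zdot p (zcross k u), zdot p u))]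
    · refine hC (c * (d * t.2 - t.1 ^ 2)) _ (by nlinarith) ?_ _ ?_
      · obtain ⟨p, hp, rfl⟩ := Finset.mem_image.1 ht
        obtain ⟨r1, r2, r3⟩ := hS p hp
        have r3' : ((2 * zdot p k - zdot k k : ℤ) : ℝ) ≤ j := by exact_mod_cast r3
        have h1 : (zdot p p : ℝ) ≤ 2 * kF ^ 2 := by nlinarith
        simp only [hf]
        push_cast
        have h2 : (d : ℝ) * zdot p p ≤ d * (2 * kF ^ 2) := by gcongr
        calc (c : ℝ) * (d * zdot p p - (zdot p k : ℝ) ^ 2) ≤ c * (d * (2 * kF ^ 2)) := by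
              gcongr
              nlinarith [sq_nonneg (zdot p k : ℝ)]
          _ = _ := by ring
      · intro s hs
        obtain ⟨p, hp, rfl⟩ := Finset.mem_image.1 hs
        have h2 := (Finset.mem_filter.1 hp).2
        rw [← h2]
        simp only [hf]
        have := gram p k u hu
        rw [← hdd, ← hcc] at this
        exact this
    · intro p hp q hq hpq
      simp only [Prod.mk.injEq] at hpq
      have h1 := (Finset.mem_filter.1 hp).2
      have h2 := (Finset.mem_filter.1 hq).2
      rw [← h2] at h1
      simp only [hf, Prod.mk.injEq] at h1
      exact zinj k u hk hu0 hu p q h1.1 hpq.2 hpq.1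
  have hTc : (T.card : ℝ) ≤ (j + d) * (j + 1) := by
    have hsub : T ⊆ Finset.Icc 1 (j + d) ×ˢ Finset.Icc (⌊kF ^ 2⌋ + 1) (⌊kF ^ 2⌋ + 1 + j) := by
      intro t ht
      obtain ⟨p, hp, rfl⟩ := Finset.mem_image.1 ht
      have h := hS p hp
      have hpos := h.pos
      obtain ⟨r1, r2, r3⟩ := h
      rw [← hdd] at r2 r3 hpos
      simp only [hf, Finset.mem_product, Finset.mem_Icc]
      refine ⟨⟨by omega, by omega⟩, Int.floor_lt.2 r1, ?_⟩
      have : zdot p p - (2 * zdot p k - d) ≤ ⌊kF ^ 2⌋ := Int.le_floor.2 (by push_cast; push_cast at r2; exact r2)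
      omega
    have h1 := Finset.card_le_card hsub
    rw [Finset.card_product, Int.card_Icc, Int.card_Icc] at h1
    have h2 : (T.card : ℤ) ≤ (j + d) * (j + 1) := by
      have e1 : ((j + d + 1 - 1 : ℤ).toNat : ℤ) = j + d := by omega
      have e2 : ((⌊kF ^ 2⌋ + 1 + j + 1 - (⌊kF ^ 2⌋ + 1) : ℤ).toNat : ℤ) = j + 1 := by omega
      rw [← e1, ← e2]; exact_mod_cast h1
    exact_mod_cast h2
  have hsum : S.card = ∑ y ∈ T, (S.filter fun s => f s = y).card :=
    Finset.card_eq_sum_card_image f S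
  have hpw : (2 * ((c : ℝ) * d) * kF ^ 2) ^ (1 / 20 : ℝ) =
      (2 * ((c : ℝ) * d)) ^ (1 / 20 : ℝ) * kF ^ (1 / 10 : ℝ) := by
    rw [Real.mul_rpow (by positivity) (by positivity), ← Real.rpow_natCast, ← Real.rpow_mul (by positivity)]
    norm_num
  rw [hsum]
  push_cast
  calc _ ≤ ∑ y ∈ T, C * (2 * ((c : ℝ) * d) * kF ^ 2) ^ (1 / 20 : ℝ) := Finset.sum_le_sum fib
    _ = T.card * (C * (2 * ((c : ℝ) * d) * kF ^ 2) ^ (1 / 20 : ℝ)) := by simp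
    _ ≤ ((j + d) * (j + 1)) * (C * (2 * ((c : ℝ) * d) * kF ^ 2) ^ (1 / 20 : ℝ)) := by gcongr
    _ ≤ (((1 + d) * j) * (2 * j)) * (C * (2 * ((c : ℝ) * d) * kF ^ 2) ^ (1 / 20 : ℝ)) := by
        gcongr
        · nlinarith
        · linarith
    _ = _ := by rw [hpw]; ring

lemma finite_ball (B : ℝ) : {q : Fin 3 → ℤ | latNorm q ≤ B}.Finite := by
  refine (Set.finite_Icc (fun _ : Fin 3 => -⌈B⌉) (fun _ : Fin 3 => ⌈B⌉)).subset ?_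
  intro q hq
  have hq : latNorm q ≤ B := hq
  have h : ∀ i, |(q i : ℝ)| ≤ B := by
    intro i
    refine le_trans ?_ hq
    rw [← Real.sqrt_sq_eq_abs]
    exact Real.sqrt_le_sqrt (Finset.single_le_sum (f := fun i => (q i : ℝ) ^ 2)
      (fun _ _ => sq_nonneg _) (Finset.mem_univ i))
  have h' : ∀ i, -⌈B⌉ ≤ q i ∧ q i ≤ ⌈B⌉ := by
    intro i
    have h1 := abs_le.1 (h i)
    have h2 := Int.le_ceil B
    constructor
    · have : ((-⌈B⌉ : ℤ) : ℝ) ≤ q i := by push_cast; linarith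
      exact_mod_cast this
    · have : (q i : ℝ) ≤ (⌈B⌉ : ℤ) := by linarith
      exact_mod_cast this
  exact ⟨fun i => (h' i).1, fun i => (h' i).2⟩

lemma card_ball_ge (kF : ℝ) (hkF : 1 ≤ kF) :
    (kF / 2) ^ 3 ≤ (Set.ncard {q : Fin 3 → ℤ | latNorm q ≤ kF} : ℝ) := by
  set t := ⌊kF / 2⌋ with ht
  have ht0 : 0 ≤ t := Int.floor_nonneg.2 (by linarith)
  have htle : (t : ℝ) ≤ kF / 2 := Int.floor_le _
  have htlt : kF / 2 < t + 1 := Int.lt_floor_add_one _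
  have hsub : ((Finset.Icc (fun _ : Fin 3 => -t) (fun _ : Fin 3 => t) : Finset (Fin 3 → ℤ)) : Set (Fin 3 → ℤ))
      ⊆ {q : Fin 3 → ℤ | latNorm q ≤ kF} := by
    intro q hq
    have hq := Finset.mem_Icc.1 (Finset.mem_coe.1 hq)
    show latNorm q ≤ kF
    unfold latNorm
    rw [Real.sqrt_le_iff]
    refine ⟨by linarith, ?_⟩
    have h : ∀ i, (q i : ℝ) ^ 2 ≤ (kF / 2) ^ 2 := by
      intro i
      have h1 : -t ≤ q i := hq.1 i
      have h2 : q i ≤ t := hq.2 i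
      have h1' : -(t : ℝ) ≤ q i := by exact_mod_cast h1
      have h2' : (q i : ℝ) ≤ t := by exact_mod_cast h2
      exact sq_le_sq' (by linarith) (by linarith)
    rw [Fin.sum_univ_three]
    nlinarith [h 0, h 1, h 2]
  have h1 := Set.ncard_le_ncard hsub (finite_ball kF)
  rw [Set.ncard_coe_finset, Pi.card_Icc] at h1
  simp only [Int.card_Icc, Finset.prod_const, Finset.card_univ, Fintype.card_fin] at h1
  have h2 : (((t + 1 - -t).toNat : ℤ)) = 2 * t + 1 := by omega
  have h3 : (((t + 1 - -t).toNat : ℝ)) = 2 * t + 1 := by exact_mod_cast h2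
  have h4 : (((t + 1 - -t).toNat : ℝ)) ^ 3 ≤ (Set.ncard {q : Fin 3 → ℤ | latNorm q ≤ kF} : ℝ) := by
    exact_mod_cast h1
  refine le_trans ?_ h4
  rw [h3]
  have : (0 : ℝ) ≤ t := by exact_mod_cast ht0
  gcongr
  linarith

lemma inv_le_sum (m M : ℕ) (hm : 1 ≤ m) (hM : m ≤ M) :
    1 / (m : ℝ) ≤ ∑ j ∈ Finset.Icc 1 (2 * M), if m ≤ j then 4 / (j : ℝ) ^ 2 else 0 := by
  have hm' : (1 : ℝ) ≤ m := by exact_mod_cast hm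
  calc 1 / (m : ℝ) = ∑ j ∈ Finset.Ico m (2 * m), 1 / (m : ℝ) ^ 2 := by
        rw [Finset.sum_const, Nat.card_Ico, nsmul_eq_mul]
        have : 2 * m - m = m := by omega
        rw [this]; field_simp
    _ ≤ ∑ j ∈ Finset.Ico m (2 * m), if m ≤ j then 4 / (j : ℝ) ^ 2 else 0 := by
        refine Finset.sum_le_sum fun j hj => ?_
        have hj := Finset.mem_Ico.1 hj
        rw [if_pos hj.1]
        have h1 : (j : ℝ) ≤ 2 * m := by exact_mod_cast hj.2.le
        have h2 : (m : ℝ) ≤ j := by exact_mod_cast hj.1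
        rw [div_le_div_iff₀ (by positivity) (by nlinarith)]
        nlinarith
    _ ≤ _ := by
        refine Finset.sum_le_sum_of_subset_of_nonneg ?_ ?_
        · intro j hj
          have hj := Finset.mem_Ico.1 hj
          exact Finset.mem_Icc.2 ⟨by omega, by omega⟩
        · intro j _ _
          split_ifs <;> positivity

/-- For every `k ∈ ℤ³ \ {0}` and every `0 < δ < 77/624` there is `C > 0`
such that for all `k_F ≥ 1`, with `N := #{q ∈ ℤ³ : |q| ≤ k_F}`, the sum of
`1/(|p|² - |p-k|²)` over all `p ∈ ℤ³` with `|p| > k_F ≥ |p-k|` and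
`|p|² - |p-k|² ≤ 4·N^(1/3-δ)` is at most `C·N^(1/3-δ)`. -/
theorem lattice_kinetic_sum_bound_equator (k : Fin 3 → ℤ) (hk : k ≠ 0)
    (δ : ℝ) (hδ0 : 0 < δ) (hδ1 : δ < 77 / 624) :
    ∃ C : ℝ, 0 < C ∧ ∀ kF : ℝ, 1 ≤ kF →
      ∃ hfin : {p : Fin 3 → ℤ | kF < latNorm p ∧ latNorm (p - k) ≤ kF ∧
          latNorm p ^ 2 - latNorm (p - k) ^ 2
            ≤ 4 * ((Set.ncard {q : Fin 3 → ℤ | latNorm q ≤ kF} : ℝ)) ^ ((1 : ℝ) / 3 - δ)}.Finite,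
        ∑ p ∈ hfin.toFinset, 1 / (latNorm p ^ 2 - latNorm (p - k) ^ 2)
          ≤ C * ((Set.ncard {q : Fin 3 → ℤ | latNorm q ≤ kF} : ℝ)) ^ ((1 : ℝ) / 3 - δ) := by
  classical
  obtain ⟨C1, hC1, hb1⟩ := count_one k hk
  obtain ⟨C2, hC2, hb2⟩ := count_two k hk
  refine ⟨8 * C2 + 64 * C1, by positivity, fun kF hkF => ?_⟩
  have hball := card_ball_ge kF hkF
  set P : ℝ := ((Set.ncard {q : Fin 3 → ℤ | latNorm q ≤ kF} : ℝ)) ^ ((1 : ℝ) / 3 - δ) with hP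
  have hP0 : 0 ≤ P := by positivity
  have hPlow : kF ^ (3 / 5 : ℝ) ≤ 2 * P := by
    have h1 : ((kF / 2) ^ 3) ^ ((1 : ℝ) / 3 - δ) ≤ P :=
      Real.rpow_le_rpow (by positivity) hball (by linarith)
    have h2 : ((kF / 2) ^ 3) ^ ((1 : ℝ) / 3 - δ) = kF ^ (1 - 3 * δ) / 2 ^ (1 - 3 * δ) := by
      rw [← Real.rpow_natCast, ← Real.rpow_mul (by positivity), ← Real.div_rpow (by positivity) (by positivity)]
      congr 1
      push_cast; ring
    have h3 : kF ^ (3 / 5 : ℝ) ≤ kF ^ (1 - 3 * δ) := Real.rpow_le_rpow_of_exponent_le hkF (by linarith)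
    have h4 : (2 : ℝ) ^ (1 - 3 * δ) ≤ 2 := by
      calc (2 : ℝ) ^ (1 - 3 * δ) ≤ 2 ^ (1 : ℝ) :=
            Real.rpow_le_rpow_of_exponent_le (by norm_num) (by linarith)
        _ = 2 := by simp
    rw [h2, div_le_iff₀ (by positivity)] at h1
    calc _ ≤ _ := h3
      _ ≤ P * 2 ^ (1 - 3 * δ) := h1
      _ ≤ P * 2 := by gcongr
      _ = _ := by ring
  have hfin : {p : Fin 3 → ℤ | kF < latNorm p ∧ latNorm (p - k) ≤ kF ∧
      latNorm p ^ 2 - latNorm (p - k) ^ 2 ≤ 4 * P}.Finite := by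
    refine Set.Finite.subset ((finite_ball kF).preimage
      (f := fun p : Fin 3 → ℤ => p - k) (sub_left_injective.injOn)) ?_
    intro p hp
    exact hp.2.1
  refine ⟨hfin, ?_⟩
  have hm : ∀ p, latNorm p ^ 2 - latNorm (p - k) ^ 2 = ((2 * zdot p k - zdot k k : ℤ) : ℝ) := by
    intro p
    rw [latNorm_sq, latNorm_sq, zdot_sub]; push_cast; ring
  set M := ⌊4 * P⌋₊ with hM
  have hMle : (M : ℝ) ≤ 4 * P := Nat.floor_le (by positivity)
  obtain ⟨m, hmdef⟩ : ∃ m : (Fin 3 → ℤ) → ℕ, ∀ p, m p = (2 * zdot p k - zdot k k).toNat :=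
    ⟨_, fun _ => rfl⟩
  have hmem : ∀ p ∈ hfin.toFinset, kF ^ 2 < (zdot p p : ℝ) ∧
      (zdot p p : ℝ) - (2 * zdot p k - zdot k k : ℤ) ≤ kF ^ 2 ∧
      ((m p : ℕ) : ℤ) = 2 * zdot p k - zdot k k ∧ 1 ≤ m p ∧ m p ≤ M := by
    intro p hp
    obtain ⟨h1, h2, h3⟩ := (Set.Finite.mem_toFinset hfin).1 hp
    have a1 : kF ^ 2 < (zdot p p : ℝ) := by
      rw [← latNorm_sq]; exact pow_lt_pow_left₀ h1 (by linarith) two_ne_zero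
    have a2 : (zdot p p : ℝ) - (2 * zdot p k - zdot k k : ℤ) ≤ kF ^ 2 := by
      rw [← hm, latNorm_sq p]
      have := pow_le_pow_left₀ (latNorm_nonneg _) h2 2
      linarith
    have a3 : (0 : ℝ) < (2 * zdot p k - zdot k k : ℤ) := by linarith
    have a4 : 0 < 2 * zdot p k - zdot k k := by exact_mod_cast a3
    have a5 : ((m p : ℕ) : ℤ) = 2 * zdot p k - zdot k k := by rw [hmdef]; omega
    refine ⟨a1, a2, a5, by omega, ?_⟩
    refine Nat.le_floor ?_
    rw [hm, ← a5] at h3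
    exact_mod_cast h3
  have hcount : ∀ j ∈ Finset.Icc 1 (2 * M),
      (∑ p ∈ hfin.toFinset, if m p ≤ j then 4 / (j : ℝ) ^ 2 else 0) ≤
        (if (j : ℝ) ^ 2 ≤ kF then 4 * C2 * kF ^ (1 / 10 : ℝ) else 0) + 8 * C1 := by
    intro j hj
    have hj1 := (Finset.mem_Icc.1 hj).1
    have hjR : (1 : ℝ) ≤ j := by exact_mod_cast hj1
    have hj2 : (0 : ℝ) < (j : ℝ) ^ 2 := by positivity
    rw [← Finset.sum_filter, Finset.sum_const, nsmul_eq_mul]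
    have hR : ∀ p ∈ hfin.toFinset.filter (fun p => m p ≤ j), Reg k kF j p := by
      intro p hp
      have hp' := Finset.mem_filter.1 hp
      obtain ⟨a1, a2, a3, a4, a5⟩ := hmem p hp'.1
      refine ⟨a1, a2, ?_⟩
      have := hp'.2
      omega
    split_ifs with h
    · have := hb2 kF hkF j hj1 (by nlinarith) _ hR
      calc _ ≤ (C2 * kF ^ (1 / 10 : ℝ) * (j : ℝ) ^ 2) * (4 / (j : ℝ) ^ 2) := by gcongr
        _ = 4 * C2 * kF ^ (1 / 10 : ℝ) := by field_simp
        _ ≤ _ := by linarith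
    · have := hb1 kF hkF j hj1 _ hR
      push Not at h
      calc _ ≤ (C1 * (kF + (j : ℝ) ^ 2)) * (4 / (j : ℝ) ^ 2) := by gcongr
        _ ≤ (C1 * ((j : ℝ) ^ 2 + (j : ℝ) ^ 2)) * (4 / (j : ℝ) ^ 2) := by gcongr
        _ = 8 * C1 := by field_simp; ring
        _ ≤ _ := by linarith
  have hsm : (((Finset.Icc 1 (2 * M)).filter fun j : ℕ => (j : ℝ) ^ 2 ≤ kF).card : ℝ) ≤ kF ^ (1 / 2 : ℝ) := by
    rw [← Real.sqrt_eq_rpow]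
    have hsub : ((Finset.Icc 1 (2 * M)).filter fun j : ℕ => (j : ℝ) ^ 2 ≤ kF) ⊆ Finset.Icc 1 ⌊√kF⌋₊ := by
      intro j hj
      have h := Finset.mem_filter.1 hj
      exact Finset.mem_Icc.2 ⟨(Finset.mem_Icc.1 h.1).1, Nat.le_floor (Real.le_sqrt_of_sq_le h.2)⟩
    have h1 := Finset.card_le_card hsub
    rw [Nat.card_Icc, Nat.add_sub_cancel] at h1
    have h2 : (((Finset.Icc 1 (2 * M)).filter fun j : ℕ => (j : ℝ) ^ 2 ≤ kF).card : ℝ) ≤ (⌊√kF⌋₊ : ℝ) := by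
      exact_mod_cast h1
    exact h2.trans (Nat.floor_le (Real.sqrt_nonneg _))
  calc ∑ p ∈ hfin.toFinset, 1 / (latNorm p ^ 2 - latNorm (p - k) ^ 2)
      ≤ ∑ p ∈ hfin.toFinset, ∑ j ∈ Finset.Icc 1 (2 * M), (if m p ≤ j then 4 / (j : ℝ) ^ 2 else 0) := by
        refine Finset.sum_le_sum fun p hp => ?_
        obtain ⟨a1, a2, a3, a4, a5⟩ := hmem p hp
        rw [hm, ← a3, Int.cast_natCast]
        exact inv_le_sum (m p) M a4 a5
    _ = ∑ j ∈ Finset.Icc 1 (2 * M), ∑ p ∈ hfin.toFinset, (if m p ≤ j then 4 / (j : ℝ) ^ 2 else 0) :=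
        Finset.sum_comm
    _ ≤ ∑ j ∈ Finset.Icc 1 (2 * M),
        ((if (j : ℝ) ^ 2 ≤ kF then 4 * C2 * kF ^ (1 / 10 : ℝ) else 0) + 8 * C1) :=
        Finset.sum_le_sum hcount
    _ = ((Finset.Icc 1 (2 * M)).filter fun j : ℕ => (j : ℝ) ^ 2 ≤ kF).card *
          (4 * C2 * kF ^ (1 / 10 : ℝ)) + 2 * M * (8 * C1) := by
        rw [Finset.sum_add_distrib, ← Finset.sum_filter, Finset.sum_const, Finset.sum_const, nsmul_eq_mul,
          nsmul_eq_mul, Nat.card_Icc, Nat.add_sub_cancel]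
        push_cast; ring
    _ ≤ kF ^ (1 / 2 : ℝ) * (4 * C2 * kF ^ (1 / 10 : ℝ)) + 2 * (4 * P) * (8 * C1) := by gcongr
    _ = 4 * C2 * kF ^ (3 / 5 : ℝ) + 64 * C1 * P := by
        have : kF ^ (3 / 5 : ℝ) = kF ^ (1 / 2 : ℝ) * kF ^ (1 / 10 : ℝ) := by
          rw [← Real.rpow_add (by linarith)]; norm_num
        rw [this]; ring
    _ ≤ 4 * C2 * (2 * P) + 64 * C1 * P := by gcongr
    _ = _ := by ring
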